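/- Let k ≥ 1 and m ∈ ℤ. Say that a smooth function b : ℝᵏ → ℂ has order ≤ μ (μ ∈ ℤ) if for every n ∈ ℕ there exists C ≥ 0 such that ‖iteratedFDeriv ℝ n b ξ‖ ≤ C·(1 + ‖ξ‖)^(μ − n) for all ξ ∈ ℝᵏ. Suppose (Qₙ)ₙ∈ℕ is a sequence of smooth functions ℝᵏ → ℂ such that Q₀ has order ≤ m and, for every n, the difference Qₙ − Qₙ₊₁ has order ≤ m − n. Then there exists a smooth function Q : ℝᵏ → ℂ such that Q − Qₙ has order ≤ m − n for every n ∈ ℕ. -/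

import Mathlib

/-- A smooth function `b : ℝᵏ → ℂ` has order `≤ μ` if all its iterated derivatives
satisfy the symbol estimates of order `μ`. -/
def HasOrderLE {k : ℕ} (μ : ℤ) (b : EuclideanSpace ℝ (Fin k) → ℂ) : Prop :=
  ∀ n : ℕ, ∃ C : ℝ, 0 ≤ C ∧ ∀ ξ : EuclideanSpace ℝ (Fin k),
    ‖iteratedFDeriv ℝ n b ξ‖ ≤ C * (1 + ‖ξ‖) ^ ((μ : ℝ) - n)

namespace HasOrderLE

variable {k : ℕ} {μ ν : ℤ} {a b : EuclideanSpace ℝ (Fin k) → ℂ}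

theorem mono (h : HasOrderLE μ b) (hμν : μ ≤ ν) : HasOrderLE ν b := by
  intro n
  obtain ⟨C, hC, hb⟩ := h n
  refine ⟨C, hC, fun ξ => (hb ξ).trans ?_⟩
  have h1 : 1 ≤ 1 + ‖ξ‖ := by linarith [norm_nonneg ξ]
  have hμν' : (μ : ℝ) ≤ ν := by exact_mod_cast hμν
  gcongr

theorem sub (ha : ContDiff ℝ (⊤ : ℕ∞) a) (hb : ContDiff ℝ (⊤ : ℕ∞) b)
    (h : HasOrderLE μ a) (h' : HasOrderLE μ b) : HasOrderLE μ (fun ξ => a ξ - b ξ) := by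
  intro n
  obtain ⟨C, hC, hCa⟩ := h n
  obtain ⟨D, hD, hDb⟩ := h' n
  refine ⟨C + D, by positivity, fun ξ => ?_⟩
  have hn : (n : WithTop ℕ∞) ≤ ((⊤ : ℕ∞) : WithTop ℕ∞) := by exact_mod_cast le_top
  rw [fun_iteratedFDeriv_sub_apply (ha.of_le hn).contDiffAt (hb.of_le hn).contDiffAt, add_mul]
  exact (norm_sub_le _ _).trans (add_le_add (hCa ξ) (hDb ξ))

theorem of_hasCompactSupport (hb : ContDiff ℝ (⊤ : ℕ∞) b) (hs : HasCompactSupport b) (μ : ℤ) :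
    HasOrderLE μ b := by
  intro n
  have hpos : ∀ ξ : EuclideanSpace ℝ (Fin k), 0 < 1 + ‖ξ‖ := fun ξ => by positivity
  have hw : Continuous fun ξ : EuclideanSpace ℝ (Fin k) => (1 + ‖ξ‖) ^ (-((μ : ℝ) - n)) :=
    (continuous_const.add continuous_norm).rpow_const fun ξ => Or.inl (hpos ξ).ne'
  have hn : (n : WithTop ℕ∞) ≤ ((⊤ : ℕ∞) : WithTop ℕ∞) := by exact_mod_cast le_top
  obtain ⟨C, hC⟩ := (hw.smul (hb.continuous_iteratedFDeriv hn)).bounded_above_of_compact_support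
    ((hs.iteratedFDeriv (𝕜 := ℝ) n).smul_left)
  refine ⟨C, (norm_nonneg _).trans (hC 0), fun ξ => ?_⟩
  have h := hC ξ
  rwa [Pi.smul_apply', norm_smul, Real.norm_of_nonneg (Real.rpow_nonneg (hpos ξ).le _),
    Real.rpow_neg (hpos ξ).le, inv_mul_le_iff₀ (Real.rpow_pos_of_pos (hpos ξ) _), mul_comm] at h

theorem const (c : ℂ) : HasOrderLE 0 (fun _ : EuclideanSpace ℝ (Fin k) => c) := by
  intro n
  refine ⟨‖c‖, norm_nonneg c, fun ξ => ?_⟩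
  rcases eq_or_ne n 0 with rfl | hn
  · simp
  · rw [iteratedFDeriv_const_of_ne hn]
    simp only [Pi.zero_apply, norm_zero]
    positivity

/-- Dilating a symbol of order zero by factors `R ≥ 1` preserves its estimates uniformly, so the
products with a symbol of order `μ` satisfy symbol estimates of order `μ` uniformly in `R`. -/
theorem exists_bound_dilation_mul (ha : ContDiff ℝ (⊤ : ℕ∞) a) (hb : ContDiff ℝ (⊤ : ℕ∞) b)
    (h : HasOrderLE 0 a) (h' : HasOrderLE μ b) (n : ℕ) :
    ∃ C : ℝ, 0 ≤ C ∧ ∀ R : ℝ, 1 ≤ R → ∀ ξ,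
      ‖iteratedFDeriv ℝ n (fun ξ => a (R⁻¹ • ξ) * b ξ) ξ‖ ≤ C * (1 + ‖ξ‖) ^ ((μ : ℝ) - n) := by
  choose A hA hAa using h
  choose B hB hBb using h'
  refine ⟨∑ i ∈ Finset.range (n + 1), n.choose i * A i * B (n - i),
    Finset.sum_nonneg fun i _ => by have := hA i; have := hB (n - i); positivity,
    fun R hR ξ => ?_⟩
  have hle : ∀ i : ℕ, (i : WithTop ℕ∞) ≤ ((⊤ : ℕ∞) : WithTop ℕ∞) := fun i => by
    exact_mod_cast le_top
  have hR0 : 0 < R := by linarith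
  have hpos : 0 < 1 + ‖ξ‖ := by positivity
  have hdil : ∀ i : ℕ, ‖iteratedFDeriv ℝ i (fun ξ => a (R⁻¹ • ξ)) ξ‖
      ≤ A i * (1 + ‖ξ‖) ^ (-(i : ℝ)) := by
    intro i
    rw [iteratedFDeriv_comp_const_smul _ (ha.of_le (hle i)), norm_smul, norm_pow,
      Real.norm_of_nonneg (inv_nonneg.2 hR0.le)]
    calc R⁻¹ ^ i * ‖iteratedFDeriv ℝ i a (R⁻¹ • ξ)‖
        ≤ R⁻¹ ^ i * (A i * (1 + ‖R⁻¹ • ξ‖) ^ (((0 : ℤ) : ℝ) - i)) := by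
          gcongr; exact hAa i _
      _ = A i * ((R + ‖ξ‖) ^ i)⁻¹ := by
          rw [norm_smul, Real.norm_of_nonneg (inv_nonneg.2 hR0.le), Int.cast_zero, zero_sub,
            Real.rpow_neg (by positivity), Real.rpow_natCast, mul_left_comm, ← inv_pow, ← inv_pow,
            ← mul_pow, ← mul_inv, mul_add, mul_one, mul_inv_cancel_left₀ hR0.ne']
      _ ≤ A i * (1 + ‖ξ‖) ^ (-(i : ℝ)) := by
          rw [Real.rpow_neg hpos.le, Real.rpow_natCast]
          have := hA i
          gcongr
  have hdila : ContDiff ℝ (⊤ : ℕ∞) (fun ξ => a (R⁻¹ • ξ)) :=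
    ha.comp (contDiff_const_smul R⁻¹)
  refine (norm_iteratedFDeriv_mul_le hdila hb ξ (hle n)).trans ?_
  rw [Finset.sum_mul]
  refine Finset.sum_le_sum fun i hi => ?_
  have hin : i ≤ n := Nat.lt_succ_iff.1 (Finset.mem_range.1 hi)
  have hAi := hA i
  calc (n.choose i : ℝ) * ‖iteratedFDeriv ℝ i (fun ξ => a (R⁻¹ • ξ)) ξ‖
        * ‖iteratedFDeriv ℝ (n - i) b ξ‖
      ≤ n.choose i * (A i * (1 + ‖ξ‖) ^ (-(i : ℝ)))
        * (B (n - i) * (1 + ‖ξ‖) ^ ((μ : ℝ) - (n - i : ℕ))) := by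
        gcongr
        · exact hdil i
        · exact hBb _ ξ
    _ = n.choose i * A i * B (n - i)
        * ((1 + ‖ξ‖) ^ (-(i : ℝ)) * (1 + ‖ξ‖) ^ ((μ : ℝ) - (n - i : ℕ))) := by ring
    _ = n.choose i * A i * B (n - i) * (1 + ‖ξ‖) ^ ((μ : ℝ) - n) := by
        rw [← Real.rpow_add hpos, Nat.cast_sub hin]
        congr 2
        ring

end HasOrderLE

/-- A smooth cutoff, of order zero as a symbol, removing the unit ball. -/
theorem exists_excision_function (k : ℕ) : ∃ χ : EuclideanSpace ℝ (Fin k) → ℂ,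
    ContDiff ℝ (⊤ : ℕ∞) χ ∧ HasOrderLE 0 χ ∧ (∀ ξ, ‖ξ‖ ≤ 1 → χ ξ = 0) ∧
      ∀ ξ, 2 ≤ ‖ξ‖ → χ ξ = 1 := by
  let φ : ContDiffBump (0 : EuclideanSpace ℝ (Fin k)) := ⟨1, 2, one_pos, one_lt_two⟩
  have hφ : ContDiff ℝ (⊤ : ℕ∞) fun ξ => (φ ξ : ℂ) := Complex.ofRealCLM.contDiff.comp φ.contDiff
  have hout : ∀ ξ, 2 ≤ ‖ξ‖ → φ ξ = 0 := fun ξ hξ => φ.zero_of_le_dist (by simpa using hξ)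
  have hsupp : HasCompactSupport fun ξ => (φ ξ : ℂ) :=
    φ.hasCompactSupport.comp_left Complex.ofReal_zero
  refine ⟨fun ξ => 1 - (φ ξ : ℂ), contDiff_const.sub hφ,
    (HasOrderLE.const 1).sub contDiff_const hφ (.of_hasCompactSupport hφ hsupp 0), ?_, ?_⟩
  · intro ξ hξ
    simp [φ.one_of_mem_closedBall (x := ξ) (by simpa using hξ)]
  · intro ξ hξ
    simp [hout ξ hξ]

/-- A symbol of order `μ` may be modified on a bounded set so that it vanishes on a given ball and
finitely many of its seminorms of order `μ + 1` become small. -/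
theorem HasOrderLE.exists_excision {k : ℕ} {μ : ℤ} {b : EuclideanSpace ℝ (Fin k) → ℂ}
    (hb : ContDiff ℝ (⊤ : ℕ∞) b) (h : HasOrderLE μ b) (J : ℕ) {ε : ℝ} (hε : 0 < ε) (R₀ : ℝ) :
    ∃ ψ : EuclideanSpace ℝ (Fin k) → ℂ, ContDiff ℝ (⊤ : ℕ∞) ψ ∧ HasOrderLE μ ψ ∧
      (∀ ξ, ‖ξ‖ ≤ R₀ → ψ ξ = 0) ∧ HasCompactSupport (fun ξ => b ξ - ψ ξ) ∧
      ∀ i ≤ J, ∀ ξ, ‖iteratedFDeriv ℝ i ψ ξ‖ ≤ ε * (1 + ‖ξ‖) ^ ((μ : ℝ) + 1 - i) := by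
  obtain ⟨χ, hχ, hχ0, hin, hout⟩ := exists_excision_function k
  choose C hC hbound using hχ0.exists_bound_dilation_mul hχ hb h
  let R : ℝ := max 1 (max R₀ (∑ i ∈ Finset.range (J + 1), C i / ε))
  have hR1 : 1 ≤ R := le_max_left _ _
  have hR0 : 0 < R := by linarith
  have hRR₀ : R₀ ≤ R := (le_max_left _ _).trans (le_max_right _ _)
  have hRC : ∀ i ≤ J, C i ≤ ε * R := fun i hi => by
    have h1 : C i / ε ≤ ∑ i ∈ Finset.range (J + 1), C i / ε :=
      Finset.single_le_sum (f := fun i => C i / ε) (fun i _ => div_nonneg (hC i) hε.le)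
        (Finset.mem_range.2 (Nat.lt_succ_of_le hi))
    have h2 : C i / ε ≤ R := h1.trans ((le_max_right _ _).trans (le_max_right _ _))
    rwa [div_le_iff₀' hε] at h2
  have hnorm : ∀ ξ : EuclideanSpace ℝ (Fin k), ‖R⁻¹ • ξ‖ = ‖ξ‖ / R := fun ξ => by
    rw [norm_smul, Real.norm_of_nonneg (inv_nonneg.2 hR0.le), div_eq_inv_mul]
  have hzero : ∀ ξ, ‖ξ‖ ≤ R → χ (R⁻¹ • ξ) * b ξ = 0 := fun ξ hξ => by
    rw [hin _ (by rw [hnorm]; exact div_le_one_of_le₀ hξ hR0.le), zero_mul]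
  refine ⟨fun ξ => χ (R⁻¹ • ξ) * b ξ, (hχ.comp (contDiff_const_smul R⁻¹)).mul hb,
    fun n => ⟨C n, hC n, hbound n R hR1⟩, fun ξ hξ => hzero ξ (hξ.trans hRR₀), ?_, ?_⟩
  · refine HasCompactSupport.intro (isCompact_closedBall 0 (2 * R)) fun ξ hξ => ?_
    have hξ' : 2 * R < ‖ξ‖ := by simpa using hξ
    beta_reduce
    rw [hout _ (by rw [hnorm, le_div_iff₀ hR0]; exact hξ'.le), one_mul, sub_self]
  · intro i hi ξ
    have hpos : 0 < 1 + ‖ξ‖ := by positivity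
    rcases lt_or_ge ‖ξ‖ R with hξ | hξ
    · have hev : (fun ξ => χ (R⁻¹ • ξ) * b ξ) =ᶠ[nhds ξ] fun _ => 0 := by
        filter_upwards [continuous_norm.continuousAt.eventually_lt_const hξ] with η hη
        exact hzero η hη.le
      rw [(hev.iteratedFDeriv ℝ i).eq_of_nhds]
      simp only [iteratedFDeriv_fun_zero, Pi.zero_apply, norm_zero]
      positivity
    · calc ‖iteratedFDeriv ℝ i (fun ξ => χ (R⁻¹ • ξ) * b ξ) ξ‖
          ≤ C i * (1 + ‖ξ‖) ^ ((μ : ℝ) - i) := hbound i R hR1 ξ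
        _ ≤ ε * (1 + ‖ξ‖) * (1 + ‖ξ‖) ^ ((μ : ℝ) - i) := by
            gcongr
            exact (hRC i hi).trans (by gcongr; linarith)
        _ = ε * (1 + ‖ξ‖) ^ ((μ : ℝ) + 1 - i) := by
            rw [mul_assoc, mul_comm (1 + ‖ξ‖), ← Real.rpow_add_one hpos.ne', sub_add_eq_add_sub]

/-- Existence of asymptotic sums of symbols of decreasing orders. -/
theorem HasOrderLE.exists_asymptotic_sum {k : ℕ} {m : ℤ} {b : ℕ → EuclideanSpace ℝ (Fin k) → ℂ}
    (hb : ∀ j, ContDiff ℝ (⊤ : ℕ∞) (b j)) (h : ∀ j : ℕ, HasOrderLE (m - j) (b j)) :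
    ∃ S : EuclideanSpace ℝ (Fin k) → ℂ, ContDiff ℝ (⊤ : ℕ∞) S ∧
      ∀ n : ℕ, HasOrderLE (m - n) (fun ξ => S ξ - ∑ j ∈ Finset.range n, b j ξ) := by
  have hle : ∀ i : ℕ, (i : WithTop ℕ∞) ≤ ((⊤ : ℕ∞) : WithTop ℕ∞) := fun i => by
    exact_mod_cast le_top
  choose ψ hψ hψo hψ0 hψs hψb using fun j =>
    (h j).exists_excision (hb j) j (ε := (1 / 2) ^ j) (by positivity) j
  let S : EuclideanSpace ℝ (Fin k) → ℂ := fun ξ => ∑ j ∈ Finset.range ⌈‖ξ‖⌉₊, ψ j ξ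
  have hS : ∀ (N : ℕ) (ξ), ‖ξ‖ ≤ N → S ξ = ∑ j ∈ Finset.range N, ψ j ξ := fun N ξ hξ =>
    Finset.sum_subset (Finset.range_subset_range.2 (Nat.ceil_le.2 hξ)) fun j _ hj =>
      hψ0 j ξ (Nat.ceil_le.1 (not_lt.1 fun hlt => hj (Finset.mem_range.2 hlt)))
  have hSev : ∀ (N : ℕ) (ξ), ‖ξ‖ < N → S =ᶠ[nhds ξ] fun ξ => ∑ j ∈ Finset.range N, ψ j ξ := by
    intro N ξ hξ
    filter_upwards [continuous_norm.continuousAt.eventually_lt_const hξ] with η hη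
    exact hS N η hη.le
  have hSsmooth : ContDiff ℝ (⊤ : ℕ∞) S := contDiff_iff_contDiffAt.2 fun ξ => by
    obtain ⟨N, hN⟩ := exists_nat_gt ‖ξ‖
    exact (ContDiff.sum fun j _ => hψ j).contDiffAt.congr_of_eventuallyEq (hSev N ξ hN)
  refine ⟨S, hSsmooth, fun n => ?_⟩
  have hheads : HasCompactSupport fun ξ => ∑ j ∈ Finset.range n, (b j ξ - ψ j ξ) := by
    induction n with
    | zero => exact HasCompactSupport.zero
    | succ n ih =>
      simp_rw [Finset.sum_range_succ]
      exact ih.add (hψs n)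
  have hhead : ContDiff ℝ (⊤ : ℕ∞) fun ξ => ∑ j ∈ Finset.range n, (b j ξ - ψ j ξ) :=
    ContDiff.sum fun j _ => (hb j).sub (hψ j)
  have htail : ContDiff ℝ (⊤ : ℕ∞) fun ξ => S ξ - ∑ j ∈ Finset.range n, ψ j ξ :=
    hSsmooth.sub (ContDiff.sum fun j _ => hψ j)
  suffices HasOrderLE (m - n) fun ξ => S ξ - ∑ j ∈ Finset.range n, ψ j ξ by
    convert this.sub htail hhead (.of_hasCompactSupport hhead hheads _) using 2 with ξ
    rw [Finset.sum_sub_distrib]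
    ring
  intro i
  choose K hK hKb using fun j => hψo j i
  let M := max (n + 1) i
  refine ⟨∑ j ∈ Finset.range M, K j + 2, by
    have := Finset.sum_nonneg fun j (_ : j ∈ Finset.range M) => hK j
    positivity, fun ξ => ?_⟩
  have h1 : 1 ≤ 1 + ‖ξ‖ := by linarith [norm_nonneg ξ]
  obtain ⟨N, hN⟩ := exists_nat_gt (max ‖ξ‖ n)
  have hNξ : ‖ξ‖ < N := (le_max_left _ _).trans_lt hN
  have hnN : n ≤ N := by exact_mod_cast ((le_max_right _ _).trans_lt hN).le
  have hev : (fun ξ => S ξ - ∑ j ∈ Finset.range n, ψ j ξ) =ᶠ[nhds ξ]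
      fun ξ => ∑ j ∈ Finset.Ico n N, ψ j ξ := by
    filter_upwards [hSev N ξ hNξ] with η hη
    rw [hη, Finset.sum_Ico_eq_sub _ hnN]
  have hterm : ∀ j, n ≤ j → ‖iteratedFDeriv ℝ i (ψ j) ξ‖ ≤
      ((if j < M then K j else 0) + (1 / 2) ^ j) * (1 + ‖ξ‖) ^ (((m - n : ℤ) : ℝ) - i) := by
    intro j hj
    split_ifs with hjM
    · have hexp : (((m - j : ℤ) : ℝ) - i) ≤ ((m - n : ℤ) : ℝ) - i := by
        have : (n : ℝ) ≤ j := by exact_mod_cast hj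
        push_cast
        linarith
      have hKj := hK j
      calc ‖iteratedFDeriv ℝ i (ψ j) ξ‖ ≤ K j * (1 + ‖ξ‖) ^ (((m - j : ℤ) : ℝ) - i) := hKb j ξ
        _ ≤ (K j + (1 / 2) ^ j) * (1 + ‖ξ‖) ^ (((m - n : ℤ) : ℝ) - i) := by
          gcongr
          exact le_add_of_nonneg_right (by positivity)
    · have hMj : M ≤ j := not_lt.1 hjM
      have hexp : (((m - j : ℤ) : ℝ) + 1 - i) ≤ ((m - n : ℤ) : ℝ) - i := by
        have : ((n + 1 : ℕ) : ℝ) ≤ j := by exact_mod_cast (le_max_left _ _).trans hMj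
        push_cast at this ⊢
        linarith
      rw [zero_add]
      refine (hψb j i ((le_max_right _ _).trans hMj) ξ).trans ?_
      gcongr
  have hsum : ∑ j ∈ Finset.Ico n N, ((if j < M then K j else 0) + (1 / 2 : ℝ) ^ j) ≤
      ∑ j ∈ Finset.range M, K j + 2 := by
    rw [Finset.sum_add_distrib, ← Finset.sum_filter]
    refine add_le_add (Finset.sum_le_sum_of_subset_of_nonneg (fun j hj => ?_) fun j _ _ => hK j) ?_
    · exact Finset.mem_range.2 (Finset.mem_filter.1 hj).2
    · exact (summable_geometric_two.sum_le_tsum _ fun j _ => by positivity).trans_eq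
        tsum_geometric_two
  rw [(hev.iteratedFDeriv ℝ i).eq_of_nhds,
    iteratedFDeriv_sum fun j _ => (hψ j).of_le (hle i), Finset.sum_apply]
  calc ‖∑ j ∈ Finset.Ico n N, iteratedFDeriv ℝ i (ψ j) ξ‖
      ≤ ∑ j ∈ Finset.Ico n N, ‖iteratedFDeriv ℝ i (ψ j) ξ‖ := norm_sum_le _ _
    _ ≤ ∑ j ∈ Finset.Ico n N, ((if j < M then K j else 0) + (1 / 2) ^ j)
          * (1 + ‖ξ‖) ^ (((m - n : ℤ) : ℝ) - i) :=
        Finset.sum_le_sum fun j hj => hterm j (Finset.mem_Ico.1 hj).1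
    _ ≤ (∑ j ∈ Finset.range M, K j + 2) * (1 + ‖ξ‖) ^ (((m - n : ℤ) : ℝ) - i) := by
        rw [← Finset.sum_mul]
        gcongr

theorem stmt_3 (k : ℕ) (hk : 1 ≤ k) (m : ℤ)
    (Q : ℕ → EuclideanSpace ℝ (Fin k) → ℂ)
    (hQsmooth : ∀ n, ContDiff ℝ (⊤ : ℕ∞) (Q n))
    (hQ0 : HasOrderLE m (Q 0))
    (hdiff : ∀ n : ℕ, HasOrderLE (m - n) (fun ξ => Q n ξ - Q (n + 1) ξ)) :
    ∃ Q' : EuclideanSpace ℝ (Fin k) → ℂ, ContDiff ℝ (⊤ : ℕ∞) Q' ∧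
      ∀ n : ℕ, HasOrderLE (m - n) (fun ξ => Q' ξ - Q n ξ) := by
  obtain ⟨S, hS, hSo⟩ := HasOrderLE.exists_asymptotic_sum
    (fun j => (hQsmooth j).sub (hQsmooth (j + 1))) hdiff
  refine ⟨fun ξ => Q 0 ξ - S ξ, (hQsmooth 0).sub hS, fun n => ?_⟩
  have hsum : ContDiff ℝ (⊤ : ℕ∞) fun ξ => ∑ j ∈ Finset.range n, (Q j ξ - Q (j + 1) ξ) :=
    ContDiff.sum fun j _ => (hQsmooth j).sub (hQsmooth (j + 1))
  have h0 : ContDiff ℝ (⊤ : ℕ∞) fun _ : EuclideanSpace ℝ (Fin k) => (0 : ℂ) := contDiff_const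
  convert (HasOrderLE.of_hasCompactSupport h0 .zero (m - n)).sub h0 (hS.sub hsum) (hSo n)
    using 2 with ξ
  rw [Finset.sum_range_sub' (fun j => Q j ξ)]
  ring
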